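/- There exists a self-dual binary linear code C ⊆ F₂^{72} whose minimum nonzero Hamming weight is 12, which contains exactly 792 codewords of Hamming weight 12 and exactly 7488 codewords of Hamming weight 14 (the weight enumerator W_{72,1} with γ = 18 and β = 396). -/

import Mathlib

/-- A subspace `C` of `(ZMod 2)^ι` is self-dual if it equals its Euclidean dual. -/
def IsSelfDual {R : Type*} [CommRing R] {ι : Type*} [Fintype ι]
    (C : Submodule R (ι → R)) : Prop :=
  ∀ x, x ∈ C ↔ ∀ y ∈ C, ∑ i, x i * y i = 0

/-- The Hamming weight of a vector: the number of nonzero coordinates. -/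
def hamWt {ι : Type*} [Fintype ι] {R : Type*} [Zero R] [DecidableEq R] (v : ι → R) : ℕ :=
  (Finset.univ.filter fun i => v i ≠ 0).card

/-- A list of words, stored by columns: the lanes of the `j`-th number in `cols`, which are
20 bits wide, hold the `j`-th bits of the words. All lanes of `ones` are `1`. -/
structure LaneBlock where
  size : ℕ
  ones : ℕ
  cols : List ℕ

namespace LaneBlock

/-! ### Computation -/

/-- Complement the lanes of `T` if `a` is odd. -/
def flipIf (M a T : ℕ) : ℕ := match a % 2 with
  | 0 => T
  | _ + 1 => M - T

def glue (M sh : ℕ) : ℕ → List ℕ → List ℕ → List ℕ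
  | a, S :: Ss, T :: Ts => (S + flipIf M a T <<< sh) :: glue M sh (a / 2) Ss Ts
  | _, _, _ => []

/-- The words of `S`, followed by the words of `T` shifted by `a`. -/
def merge (a : ℕ) (S T : LaneBlock) : LaneBlock :=
  ⟨S.size + T.size, S.ones + T.ones <<< (20 * S.size), glue T.ones (20 * S.size) a S.cols T.cols⟩

def step (a : ℕ) : List LaneBlock → List LaneBlock
  | T :: S :: Bs => merge a S T :: step a (S :: Bs)
  | _ => []

/-- The lanes of the result are the weights of the words shifted by `a`. -/
def weights (M : ℕ) : ℕ → List ℕ → ℕ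
  | a, T :: Ts => flipIf M a T + weights M (a / 2) Ts
  | _, [] => 0

/-- The number of lanes of `W` that are at least `s`. -/
def countGe (M W s : ℕ) : ℕ := (((W + (64 - s) * M) >>> 6) &&& M) % 1048575

def countRange (lo hi a : ℕ) (B : LaneBlock) : ℕ :=
  let W := weights B.ones a B.cols
  countGe B.ones W lo - countGe B.ones W hi

/-- For `l = a₁ :: a₂ :: ⋯`, the blocks of the `k`-fold sums of `l` for `k ≤ q`, and for each
suffix of `l` the block of its `q`-fold sums. -/
def table (q : ℕ) : List ℕ → List LaneBlock × List (ℕ × LaneBlock)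
  | [] => (⟨1, 1, List.replicate 36 0⟩ :: List.replicate q ⟨0, 0, List.replicate 36 0⟩, [])
  | a :: l =>
    let p := table q l
    let s := ⟨1, 1, List.replicate 36 0⟩ :: step a p.1
    (s, (a, s.getLastD ⟨0, 0, []⟩) :: p.2)

def search (lo hi : ℕ) : ℕ → List (ℕ × LaneBlock) → ℕ → ℕ
  | 0, [], _ => 0
  | 0, p :: _, a => countRange lo hi a p.2
  | _ + 1, [], _ => 0
  | d + 1, p :: t, a => search lo hi (d + 1) t a + search lo hi d t (a ^^^ p.1)

/-! ### Packed lists -/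

def pack : List ℕ → ℕ
  | [] => 0
  | x :: L => x + 2 ^ 20 * pack L

theorem pack_append (L L' : List ℕ) :
    pack (L ++ L') = pack L + pack L' <<< (20 * L.length) := by
  induction L with
  | nil => simp [pack]
  | cons x L ih =>
    simp only [List.cons_append, pack, ih, Nat.shiftLeft_eq, List.length_cons]
    ring

theorem pack_map_add {α : Type*} (f g : α → ℕ) (L : List α) :
    pack (L.map fun x => f x + g x) = pack (L.map f) + pack (L.map g) := by
  induction L with
  | nil => simp [pack]
  | cons x L ih => simp only [List.map_cons, pack, ih]; ring

def onesOf (L : List ℕ) : ℕ := pack (L.map fun _ => 1)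

theorem onesOf_map (f : ℕ → ℕ) (L : List ℕ) : onesOf (L.map f) = onesOf L := by
  simp [onesOf, Function.comp_def]

theorem pack_map_const (c : ℕ) (L : List ℕ) : pack (L.map fun _ => c) = c * onesOf L := by
  induction L with
  | nil => simp [pack, onesOf]
  | cons x L ih => simp only [onesOf, List.map_cons, pack] at ih ⊢; rw [ih]; ring

theorem shiftRight_pack_land (L : List ℕ) (hL : ∀ x ∈ L, x < 2 ^ 20) :
    (pack L >>> 6) &&& onesOf L = pack (L.map fun x => x / 64 % 2) := by
  induction L with
  | nil => simp [pack, onesOf]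
  | cons x L ih =>
    have hx : x < 2 ^ 20 := hL x (by simp)
    have ih := ih fun y hy => hL y (by simp [hy])
    simp only [onesOf, List.map_cons, pack] at ih ⊢
    rw [← ih]
    refine Nat.eq_of_testBit_eq fun i => ?_
    have h1 : (1 : ℕ) < 2 ^ 20 := by norm_num
    have h2 : x / 64 % 2 < 2 ^ 20 := (Nat.mod_lt _ (by norm_num)).trans (by norm_num)
    rw [Nat.testBit_and, Nat.testBit_shiftRight, add_comm x, add_comm 1 (2 ^ 20 * _),
      add_comm (x / 64 % 2), Nat.testBit_two_pow_mul_add _ hx, Nat.testBit_two_pow_mul_add _ h1,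
      Nat.testBit_two_pow_mul_add _ h2]
    by_cases hi : i < 20
    · simp only [hi, if_true]
      rcases Nat.eq_zero_or_pos i with rfl | hpos
      · simp [Nat.testBit_eq_decide_div_mod_eq]
      · have h3 : Nat.testBit 1 i = false := Nat.testBit_lt_two_pow
          (by simpa using Nat.pow_lt_pow_right (a := 2) (by norm_num) hpos)
        have h4 : (x / 64 % 2).testBit i = false :=
          Nat.testBit_lt_two_pow ((Nat.mod_lt _ (by norm_num)).trans_le
            (by simpa using Nat.pow_le_pow_right (n := 2) (by norm_num) hpos))
        simp [h3, h4]
    · have h5 : ¬ 6 + i < 20 := by omega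
      simp only [hi, h5, if_false]
      rw [Nat.testBit_and, Nat.testBit_shiftRight]
      congr 2
      omega

theorem pack_mod (L : List ℕ) (hL : L.sum < 1048575) : pack L % 1048575 = L.sum := by
  have h : pack L ≡ L.sum [MOD 1048575] := by
    clear hL
    induction L with
    | nil => rfl
    | cons x L ih =>
      have h1 : 2 ^ 20 ≡ 1 [MOD 1048575] := rfl
      simpa [pack] using (h1.mul ih).add_left x
  rw [h, Nat.mod_eq_of_lt hL]

theorem countGe_pack (L : List ℕ) (s : ℕ) (hs : s ≤ 64) (hL : ∀ x ∈ L, x < 64)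
    (hlen : L.length < 1048575) :
    countGe (onesOf L) (pack L) s = L.countP (s ≤ ·) := by
  have hsum : (L.map fun x => (x + (64 - s)) / 64 % 2).sum = L.countP (s ≤ ·) := by
    clear hlen
    induction L with
    | nil => rfl
    | cons x L ih =>
      have hx := hL x (by simp)
      rw [List.map_cons, List.sum_cons, ih fun y hy => hL y (by simp [hy]), List.countP_cons]
      simp only [decide_eq_true_eq]
      split_ifs <;> omega
  have hadd : pack L + (64 - s) * onesOf L = pack (L.map fun x => x + (64 - s)) := by
    rw [pack_map_add (fun x => x), pack_map_const, List.map_id']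
  have hland := shiftRight_pack_land (L.map fun x => x + (64 - s)) (by
    simp only [List.mem_map, forall_exists_index, and_imp]
    rintro _ y hy rfl
    have := hL y hy
    omega)
  rw [onesOf_map, List.map_map] at hland
  rw [countGe, hadd, hland, ← hsum]
  refine pack_mod _ ?_
  change (L.map fun x => (x + (64 - s)) / 64 % 2).sum < _
  rw [hsum]
  exact List.countP_le_length.trans_lt hlen

/-! ### Blocks of words -/

/-- The number of nonzero bits among the lowest `n` bits. -/
def popcount : ℕ → ℕ → ℕ
  | 0, _ => 0
  | n + 1, a => a % 2 + popcount n (a / 2)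

theorem popcount_le (n a : ℕ) : popcount n a ≤ n := by
  induction n generalizing a with
  | zero => rfl
  | succ n ih =>
    have := ih (a / 2)
    simp only [popcount]
    omega

def columns : ℕ → List ℕ → List ℕ
  | 0, _ => []
  | n + 1, L => pack (L.map (· % 2)) :: columns n (L.map (· / 2))

def ofWords (L : List ℕ) : LaneBlock := ⟨L.length, onesOf L, columns 36 L⟩

theorem flipIf_onesOf (a : ℕ) (L : List ℕ) :
    flipIf (onesOf L) a (pack (L.map (· % 2))) = pack (L.map fun x => (a ^^^ x) % 2) := by
  unfold flipIf
  split
  next h =>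
    congr 1
    refine List.map_congr_left fun x _ => ?_
    simp only [Nat.xor_mod_two_eq]
    omega
  next h =>
    have : onesOf L = pack (L.map fun x => (a ^^^ x) % 2) + pack (L.map (· % 2)) := by
      rw [← pack_map_add, onesOf]
      congr 1
      refine List.map_congr_left fun x _ => ?_
      simp only [Nat.xor_mod_two_eq]
      omega
    omega

theorem map_xor_div_two (a : ℕ) (L : List ℕ) :
    (L.map (a ^^^ ·)).map (· / 2) = (L.map (· / 2)).map (a / 2 ^^^ ·) := by
  simp [Nat.xor_div_two]

theorem glue_columns (n a : ℕ) (S T : List ℕ) :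
    glue (onesOf T) (20 * S.length) a (columns n S) (columns n T) =
      columns n (S ++ T.map (a ^^^ ·)) := by
  induction n generalizing a S T with
  | zero => rfl
  | succ n ih =>
    have := ih (a / 2) (S.map (· / 2)) (T.map (· / 2))
    rw [onesOf_map, List.length_map] at this
    simp only [columns, glue, this, flipIf_onesOf, List.map_append, pack_append, List.length_map,
      map_xor_div_two]
    simp [Function.comp_def]

theorem merge_ofWords (a : ℕ) (S T : List ℕ) :
    merge a (ofWords S) (ofWords T) = ofWords (S ++ T.map (a ^^^ ·)) := by
  have h : onesOf (S ++ T.map (a ^^^ ·)) = onesOf S + onesOf T <<< (20 * S.length) := by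
    rw [onesOf, List.map_append, pack_append, List.length_map, ← onesOf, ← onesOf, onesOf_map]
  simp only [merge, ofWords, glue_columns]
  rw [h, List.length_append, List.length_map]

theorem weights_columns (n a : ℕ) (L : List ℕ) :
    weights (onesOf L) a (columns n L) = pack (L.map fun x => popcount n (a ^^^ x)) := by
  induction n generalizing a L with
  | zero => simp only [columns, weights, popcount, pack_map_const, zero_mul]
  | succ n ih =>
    have := ih (a / 2) (L.map (· / 2))
    rw [onesOf_map] at this
    simp only [columns, weights, this, flipIf_onesOf, popcount, pack_map_add, List.map_map,
      Function.comp_def, Nat.xor_div_two]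

theorem countRange_ofWords {lo hi : ℕ} (hlo : lo ≤ hi) (hhi : hi ≤ 64) (a : ℕ) (L : List ℕ)
    (hL : L.length < 1048575) :
    countRange lo hi a (ofWords L) =
      (L.map (a ^^^ ·)).countP fun x => lo ≤ popcount 36 x ∧ popcount 36 x < hi := by
  have hones : onesOf L = onesOf (L.map fun x => popcount 36 (a ^^^ x)) := (onesOf_map _ _).symm
  have hlt : ∀ x ∈ L.map fun x => popcount 36 (a ^^^ x), x < 64 := by
    simp only [List.mem_map, forall_exists_index, and_imp]
    rintro _ x _ rfl
    exact (popcount_le _ _).trans_lt (by norm_num)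
  simp only [countRange, ofWords, weights_columns]
  rw [hones, countGe_pack _ _ (hlo.trans hhi) hlt (by simpa), countGe_pack _ _ hhi hlt (by simpa)]
  clear hones hlt hL
  rw [Nat.sub_eq_iff_eq_add' (List.countP_mono_left fun x _ h => by
    simp only [decide_eq_true_eq] at h ⊢; omega)]
  induction L with
  | nil => rfl
  | cons x L ih =>
    simp only [List.map_cons, List.countP_cons, ih, decide_eq_true_eq]
    split_ifs <;> omega

/-! ### The search -/

/-- The sums of `k` entries of `l` at distinct positions. -/
def sums (k : ℕ) (l : List ℕ) : List ℕ := (l.sublistsLen k).map (List.foldr (· ^^^ ·) 0)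

theorem sums_zero (l : List ℕ) : sums 0 l = [0] := by simp [sums]

theorem sums_succ_nil (k : ℕ) : sums (k + 1) [] = [] := by simp [sums]

theorem sums_succ_cons (k a : ℕ) (l : List ℕ) :
    sums (k + 1) (a :: l) = sums (k + 1) l ++ (sums k l).map (a ^^^ ·) := by
  simp [sums, List.sublistsLen_succ_cons]

theorem length_sums (k : ℕ) (l : List ℕ) : (sums k l).length = l.length.choose k := by
  simp [sums, List.length_sublistsLen]

theorem ofWords_zero : ofWords [0] = ⟨1, 1, List.replicate 36 0⟩ := rfl

theorem ofWords_nil : ofWords [] = ⟨0, 0, List.replicate 36 0⟩ := rfl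

theorem step_sums (a m k : ℕ) (l : List ℕ) :
    step a ((List.range' k (m + 1)).map fun i => ofWords (sums i l)) =
      (List.range' (k + 1) m).map fun i => ofWords (sums i (a :: l)) := by
  induction m generalizing k with
  | zero => rfl
  | succ m ih =>
    have := ih (k + 1)
    simp only [List.range'_succ, List.map_cons, step, merge_ofWords, sums_succ_cons] at this ⊢
    rw [this]

theorem table_fst (q : ℕ) (l : List ℕ) :
    (table q l).1 = (List.range' 0 (q + 1)).map fun i => ofWords (sums i l) := by
  induction l with
  | nil =>
    simp only [table, List.range'_succ, List.map_cons, sums_zero, ofWords_zero, List.cons.injEq,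
      true_and, ← ofWords_nil]
    symm
    rw [List.eq_replicate_iff]
    refine ⟨by simp, fun b hb => ?_⟩
    obtain ⟨i, hi, rfl⟩ := List.mem_map.mp hb
    obtain ⟨j, rfl⟩ : ∃ j, i = j + 1 := ⟨i - 1, by have := (List.mem_range'_1.mp hi).1; omega⟩
    rw [sums_succ_nil]
  | cons a l ih =>
    simp only [table]
    rw [ih, step_sums, List.range'_succ, List.map_cons, sums_zero, ofWords_zero]

theorem table_snd_cons (q a : ℕ) (l : List ℕ) :
    (table q (a :: l)).2 = (a, ofWords (sums q (a :: l))) :: (table q l).2 := by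
  have h := table_fst q (a :: l)
  simp only [table] at h ⊢
  rw [h, List.range'_concat]
  simp

theorem search_table {lo hi : ℕ} (hlo : lo ≤ hi) (hhi : hi ≤ 64) (q d a : ℕ) (l : List ℕ)
    (hl : l.length.choose (q + 1) < 1048575) :
    search lo hi d (table (q + 1) l).2 a =
      ((sums (d + (q + 1)) l).map (a ^^^ ·)).countP
        fun x => lo ≤ popcount 36 x ∧ popcount 36 x < hi := by
  induction l generalizing d a with
  | nil => rw [← add_assoc, sums_succ_nil]; cases d <;> rfl
  | cons b l ih =>
    rw [table_snd_cons]
    cases d with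
    | zero => rw [search, countRange_ofWords hlo hhi _ _ (by rwa [length_sums]), zero_add]
    | succ d =>
      have hl' := (Nat.choose_le_choose (q + 1) (Nat.le_succ l.length)).trans_lt hl
      rw [search, ih _ _ hl', ih _ _ hl', add_right_comm d 1,
        sums_succ_cons (d + (q + 1)), List.map_append,
        List.countP_append, List.map_map]
      simp only [Function.comp_def, Nat.xor_assoc]

end LaneBlock

/-! ### Self-dual codes from symmetric orthogonal matrices -/

theorem hamWt_append {R : Type*} [Zero R] [DecidableEq R] {m n : ℕ} (u : Fin m → R)
    (v : Fin n → R) : hamWt (Fin.append u v) = hamWt u + hamWt v := by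
  simp only [hamWt, Finset.card_filter, Fin.sum_univ_add, Fin.append_left, Fin.append_right]

theorem hamWt_eq_zero {ι R : Type*} [Fintype ι] [Zero R] [DecidableEq R] {v : ι → R} :
    hamWt v = 0 ↔ v = 0 := by
  simp [hamWt, Finset.filter_eq_empty_iff, funext_iff]

/-- The code with generator matrix `(1 | Aᵀ)`. -/
def graphCode {R : Type*} [CommRing R] {m n : ℕ} (A : Matrix (Fin n) (Fin m) R) :
    Submodule R (Fin (m + n) → R) :=
  LinearMap.eqLocus (LinearMap.funLeft R R (Fin.natAdd m))
    (A.mulVecLin ∘ₗ LinearMap.funLeft R R (Fin.castAdd n))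

theorem append_mem_graphCode {R : Type*} [CommRing R] {m n : ℕ} {A : Matrix (Fin n) (Fin m) R}
    {u : Fin m → R} {v : Fin n → R} : Fin.append u v ∈ graphCode A ↔ v = A.mulVec u := by
  simp [graphCode, LinearMap.mem_eqLocus, LinearMap.funLeft, Function.comp_def]

theorem sum_append_mul_append {R : Type*} [CommRing R] {m n : ℕ} (u u' : Fin m → R)
    (v v' : Fin n → R) :
    ∑ i, Fin.append u v i * Fin.append u' v' i = u ⬝ᵥ u' + v ⬝ᵥ v' := by
  simp [Fin.sum_univ_add, dotProduct]

section

variable {R : Type*} [CommRing R] [CharP R 2] {n : ℕ} {A : Matrix (Fin n) (Fin n) R}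

theorem isSelfDual_graphCode (hA : A.IsSymm) (hAA : A * A = 1) : IsSelfDual (graphCode A) := by
  have hdot (u v : Fin n → R) : A.mulVec u ⬝ᵥ A.mulVec v = u ⬝ᵥ v := by
    rw [Matrix.dotProduct_mulVec, ← Matrix.mulVec_transpose, hA.eq, Matrix.mulVec_mulVec, hAA,
      Matrix.one_mulVec]
  intro x
  obtain ⟨u, v, rfl⟩ : ∃ u v, x = Fin.append u v :=
    ⟨_, _, (Fin.append_castAdd_natAdd (f := x)).symm⟩
  constructor
  · rintro hx y hy
    obtain ⟨u', v', rfl⟩ : ∃ u v, y = Fin.append u v :=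
      ⟨_, _, (Fin.append_castAdd_natAdd (f := y)).symm⟩
    rw [append_mem_graphCode] at hx hy
    rw [sum_append_mul_append, hx, hy, hdot, CharTwo.add_self_eq_zero]
  · intro h
    rw [append_mem_graphCode]
    have h0 : u + A.mulVec v = 0 := by
      refine dotProduct_eq_zero _ fun w => ?_
      have := h (Fin.append w (A.mulVec w)) (append_mem_graphCode.2 rfl)
      rw [sum_append_mul_append] at this
      rw [← this, add_dotProduct, ← hdot (A.mulVec v) w, Matrix.mulVec_mulVec, hAA,
        Matrix.one_mulVec]
    have h1 : u = A.mulVec v := funext fun i => CharTwo.add_eq_zero.1 (congrFun h0 i)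
    rw [h1, Matrix.mulVec_mulVec, hAA, Matrix.one_mulVec]

end

section

variable {R : Type*} [CommRing R] [DecidableEq R] [Fintype R] {n : ℕ}
  (A : Matrix (Fin n) (Fin n) R)

/-- The number of words `(u, A u)` with `u` of weight `i` and `A u` of weight `j`. -/
def biweightCount (i j : ℕ) : ℕ :=
  (Finset.univ.filter fun u : Fin n → R => hamWt u = i ∧ hamWt (A.mulVec u) = j).card

theorem sum_biweightCount (i lo hi : ℕ) :
    ∑ j ∈ Finset.Ico lo hi, biweightCount A i j = (Finset.univ.filter fun u : Fin n → R =>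
      hamWt u = i ∧ lo ≤ hamWt (A.mulVec u) ∧ hamWt (A.mulVec u) < hi).card := by
  rw [Finset.card_eq_sum_card_fiberwise (f := fun u => hamWt (A.mulVec u))
    (t := Finset.Ico lo hi) (by intro u hu; simpa using (Finset.mem_filter.1 hu).2.2)]
  refine Finset.sum_congr rfl fun j hj => ?_
  rw [biweightCount, Finset.filter_filter]
  congr 1
  refine Finset.filter_congr fun u _ => ?_
  rw [Finset.mem_Ico] at hj
  omega

variable {A}

theorem biweightCount_comm (hAA : A * A = 1) (i j : ℕ) :
    biweightCount A i j = biweightCount A j i := by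
  refine Finset.card_nbij' A.mulVec A.mulVec ?_ ?_ ?_ ?_ <;> intro u hu <;>
    simp_all [Matrix.mulVec_mulVec]

theorem biweightCount_zero_left {j : ℕ} (hj : j ≠ 0) : biweightCount A 0 j = 0 := by
  rw [biweightCount, Finset.card_eq_zero, Finset.filter_eq_empty_iff]
  rintro u - ⟨hu, hu'⟩
  rw [hamWt_eq_zero] at hu
  rw [hu, Matrix.mulVec_zero, hamWt_eq_zero.2 rfl] at hu'
  exact hj hu'.symm

theorem card_graphCode_weight (w : ℕ) :
    Nat.card {x : Fin (n + n) → R // x ∈ graphCode A ∧ hamWt x = w} =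
      ∑ i ∈ Finset.range (w + 1), biweightCount A i (w - i) := by
  have e : {x : Fin (n + n) → R // x ∈ graphCode A ∧ hamWt x = w} ≃
      {u : Fin n → R // hamWt u + hamWt (A.mulVec u) = w} :=
    { toFun := fun x => ⟨fun i => x.1 (Fin.castAdd n i), by
        obtain ⟨x, hx, hw⟩ := x
        rw [← Fin.append_castAdd_natAdd (f := x), hamWt_append] at hw
        convert hw using 3
        exact hx.symm⟩
      invFun := fun u => ⟨Fin.append u.1 (A.mulVec u.1), append_mem_graphCode.2 rfl,
        (hamWt_append _ _).trans u.2⟩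
      left_inv := fun x => Subtype.ext <|
        (congrArg (Fin.append _) x.2.1.symm).trans Fin.append_castAdd_natAdd
      right_inv := fun u => Subtype.ext (funext fun i => Fin.append_left _ _ i) }
  rw [Nat.card_congr e, Nat.card_eq_fintype_card, Fintype.card_subtype,
    Finset.card_eq_sum_card_fiberwise (f := hamWt) (t := Finset.range (w + 1))
      (by intro u hu; simp at hu ⊢; omega)]
  refine Finset.sum_congr rfl fun i hi => ?_
  rw [biweightCount, Finset.filter_filter]
  congr 1
  refine Finset.filter_congr fun u _ => ?_
  rw [Finset.mem_range] at hi
  omega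

theorem le_hamWt_of_mem_graphCode (hAA : A * A = 1) {d : ℕ}
    (h : ∀ i j, i ≤ j → 0 < i → i + j < d → biweightCount A i j = 0) {x : Fin (n + n) → R}
    (hx : x ∈ graphCode A) (h0 : x ≠ 0) : d ≤ hamWt x := by
  obtain ⟨u, v, rfl⟩ : ∃ u v, x = Fin.append u v :=
    ⟨_, _, (Fin.append_castAdd_natAdd (f := x)).symm⟩
  rw [append_mem_graphCode] at hx
  subst hx
  rw [hamWt_append]
  by_contra! hlt
  have hu : u ≠ 0 := by
    rintro rfl
    refine h0 (funext fun i => ?_)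
    rw [Matrix.mulVec_zero]
    induction i using Fin.addCases with
    | left i => exact Fin.append_left _ _ i
    | right i => exact Fin.append_right _ _ i
  have hv : A.mulVec u ≠ 0 := fun hv => hu (by
    rw [← Matrix.one_mulVec u, ← hAA, ← Matrix.mulVec_mulVec, hv, Matrix.mulVec_zero])
  have hpos : 0 < biweightCount A (hamWt u) (hamWt (A.mulVec u)) :=
    Finset.card_pos.2 ⟨u, by simp⟩
  have hu' := Nat.pos_of_ne_zero (hamWt_eq_zero.not.2 hu)
  have hv' := Nat.pos_of_ne_zero (hamWt_eq_zero.not.2 hv)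
  rcases le_total (hamWt u) (hamWt (A.mulVec u)) with hle | hle
  · exact hpos.ne' (h _ _ hle hu' hlt)
  · rw [biweightCount_comm hAA] at hpos
    exact hpos.ne' (h _ _ hle hv' (by omega))

end

/-! ### Words as vectors -/

/-- The vector of the lowest `n` bits of a number. -/
def bits (n a : ℕ) : Fin n → ZMod 2 := fun j => if a.testBit j then 1 else 0

theorem bits_zero (n : ℕ) : bits n 0 = 0 := by ext; simp [bits]

theorem bits_xor (n a b : ℕ) : bits n (a ^^^ b) = bits n a + bits n b := by
  ext j
  simp only [bits, Nat.testBit_xor, Pi.add_apply]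
  cases a.testBit j <;> cases b.testBit j <;> decide

theorem hamWt_cons {R : Type*} [Zero R] [DecidableEq R] {n : ℕ} (x : R) (v : Fin n → R) :
    hamWt (Fin.cons x v : Fin (n + 1) → R) = (if x ≠ 0 then 1 else 0) + hamWt v := by
  simp only [hamWt, Finset.card_filter, Fin.sum_univ_succ, Fin.cons_zero, Fin.cons_succ]

theorem bits_succ (n a : ℕ) :
    bits (n + 1) a = Fin.cons (if a.testBit 0 then 1 else 0) (bits n (a / 2)) := by
  ext j
  induction j using Fin.cases <;> simp [bits, Nat.testBit_succ]

theorem hamWt_bits (n a : ℕ) : hamWt (bits n a) = LaneBlock.popcount n a := by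
  induction n generalizing a with
  | zero => rfl
  | succ n ih =>
    rw [bits_succ, hamWt_cons, ih, LaneBlock.popcount, Nat.testBit_zero]
    rcases Nat.mod_two_eq_zero_or_one a with h | h <;> simp [h]

theorem card_filter_hamWt {V : Type*} [AddCommGroup V] [Module (ZMod 2) V] {g : ℕ → V}
    (g_zero : g 0 = 0) (g_xor : ∀ a b, g (a ^^^ b) = g a + g b) {n : ℕ} (f : Fin n → ℕ) (k : ℕ)
    (P : V → Prop) [DecidablePred P] :
    (Finset.univ.filter fun u : Fin n → ZMod 2 => hamWt u = k ∧ P (∑ i, u i • g (f i))).card =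
      (LaneBlock.sums k (List.ofFn f)).countP fun x => P (g x) := by
  induction n generalizing k P with
  | zero =>
    cases k with
    | zero =>
      simp only [LaneBlock.sums_zero, List.countP_singleton, g_zero, Finset.card_filter]
      simp [hamWt]
    | succ k => simp [LaneBlock.sums_succ_nil, hamWt]
  | succ n ih =>
    have sum_two (F : ZMod 2 → ℕ) : ∑ x, F x = F 0 + F 1 := Fin.sum_univ_two F
    have hamWt_consEquiv (p : ZMod 2 × (Fin n → ZMod 2)) :
        hamWt (Fin.consEquiv (fun _ => ZMod 2) p) = (if p.1 ≠ 0 then 1 else 0) + hamWt p.2 :=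
      hamWt_cons p.1 p.2
    simp only [Finset.card_filter] at ih ⊢
    rw [← (Fin.consEquiv fun _ => ZMod 2).sum_comp, Fintype.sum_prod_type, sum_two]
    simp only [hamWt_consEquiv, Fin.consEquiv_apply, Fin.sum_univ_succ, Fin.cons_zero, Fin.cons_succ,
      zero_smul, one_smul, zero_add, ne_eq, not_true_eq_false, one_ne_zero, not_false_eq_true,
      if_true, if_false, List.ofFn_succ]
    cases k with
    | zero =>
      simp only [ih _ 0 P, LaneBlock.sums_zero]
      simp [g_zero]
    | succ k =>
      simp only [ih _ (k + 1) P, LaneBlock.sums_succ_cons, List.countP_append, List.countP_map,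
        add_comm 1, Nat.add_right_cancel_iff, ih _ k fun y => P (g (f 0) + y)]
      simp [Function.comp_def, g_xor]

/-- The matrix whose rows are the vectors of the lowest bits of the given words. -/
def bitMatrix {n : ℕ} (f : Fin n → ℕ) : Matrix (Fin n) (Fin n) (ZMod 2) :=
  Matrix.of fun i => bits n (f i)

theorem sum_biweightCount_bitMatrix {f : Fin 36 → ℕ} (hf : (bitMatrix f).IsSymm) {lo hi : ℕ}
    (hlo : lo ≤ hi) (hhi : hi ≤ 64) {q : ℕ} (d : ℕ) (hq : Nat.choose 36 (q + 1) < 1048575) :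
    ∑ t ∈ Finset.Ico lo hi, biweightCount (bitMatrix f) (d + (q + 1)) t =
      LaneBlock.search lo hi d (LaneBlock.table (q + 1) (List.ofFn f)).2 0 := by
  have h (u : Fin 36 → ZMod 2) : (bitMatrix f).mulVec u = ∑ i, u i • bits 36 (f i) := by
    rw [← hf.eq, Matrix.mulVec_transpose, Matrix.vecMul_eq_sum]
    rfl
  rw [LaneBlock.search_table hlo hhi q d 0 _ (by rwa [List.length_ofFn]), sum_biweightCount]
  simp only [h]
  refine (card_filter_hamWt (bits_zero 36) (bits_xor 36) f _
    fun y => lo ≤ hamWt y ∧ hamWt y < hi).trans ?_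
  simp [hamWt_bits]

/-! ### The code -/

/-- The rows of the matrix, as binary numbers. -/
def codeRows : List ℕ :=
  [23629660084, 45305970238, 3636379467, 64494884046, 30784446899, 19863137395, 30557965164,
    67643827481, 23766669781, 59275024967, 25375453359, 40516635495, 58276431631, 32280437943,
    43862997177, 58902748621, 23271707257, 46339005863, 33155318901, 2631998757, 11602849550,
    20408225023, 55698836723, 8906119604, 63121199840, 37074749616, 33089448682, 42145353718,
    67878310116, 32335318160, 1482886660, 50457393063, 46104166361, 50291171546, 18075727865,
    15489751690]

def codeMatrix : Matrix (Fin 36) (Fin 36) (ZMod 2) :=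
  bitMatrix fun i => codeRows.get i

theorem isSymm_codeMatrix : codeMatrix.IsSymm := by
  decide +kernel

theorem codeMatrix_mul_self : codeMatrix * codeMatrix = 1 := by
  decide +kernel

theorem sum_biweightCount_codeMatrix {lo hi : ℕ} (hlo : lo ≤ hi) (hhi : hi ≤ 64) {q : ℕ} (d : ℕ)
    (hq : q ≤ 4) : ∑ t ∈ Finset.Ico lo hi, biweightCount codeMatrix (d + (q + 1)) t =
      LaneBlock.search lo hi d (LaneBlock.table (q + 1) codeRows).2 0 := by
  have hq : Nat.choose 36 (q + 1) < 1048575 := by interval_cases q <;> norm_num [Nat.choose]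
  rw [codeMatrix, sum_biweightCount_bitMatrix isSymm_codeMatrix hlo hhi d hq,
    show List.ofFn (fun i : Fin 36 => codeRows.get i) = codeRows from List.ofFn_get codeRows]

theorem biweightCount_codeMatrix {q : ℕ} (d t : ℕ) (hq : q ≤ 4) (ht : t < 64) :
    biweightCount codeMatrix (d + (q + 1)) t =
      LaneBlock.search t (t + 1) d (LaneBlock.table (q + 1) codeRows).2 0 := by
  rw [← sum_biweightCount_codeMatrix t.le_succ ht d hq, Nat.Ico_succ_singleton,
    Finset.sum_singleton]

theorem biweightCount_codeMatrix_one :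
    biweightCount codeMatrix 1 11 = 1 ∧ biweightCount codeMatrix 1 13 = 0 := by
  constructor <;>
    exact (biweightCount_codeMatrix (q := 0) 0 _ (by norm_num) (by norm_num)).trans
      (by decide +kernel)

theorem biweightCount_codeMatrix_two :
    biweightCount codeMatrix 2 10 = 4 ∧ biweightCount codeMatrix 2 12 = 19 := by
  constructor <;>
    exact (biweightCount_codeMatrix (q := 1) 0 _ (by norm_num) (by norm_num)).trans
      (by decide +kernel)

theorem biweightCount_codeMatrix_three :
    biweightCount codeMatrix 3 9 = 31 ∧ biweightCount codeMatrix 3 11 = 88 := by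
  constructor <;>
    exact (biweightCount_codeMatrix (q := 2) 0 _ (by norm_num) (by norm_num)).trans
      (by decide +kernel)

theorem biweightCount_codeMatrix_four :
    biweightCount codeMatrix 4 8 = 88 ∧ biweightCount codeMatrix 4 10 = 366 := by
  constructor <;>
    exact (biweightCount_codeMatrix (q := 3) 0 _ (by norm_num) (by norm_num)).trans
      (by decide +kernel)

theorem biweightCount_codeMatrix_five :
    biweightCount codeMatrix 5 7 = 169 ∧ biweightCount codeMatrix 5 9 = 857 := by
  constructor <;>
    exact (biweightCount_codeMatrix (q := 4) 0 _ (by norm_num) (by norm_num)).trans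
      (by decide +kernel)

theorem biweightCount_codeMatrix_six :
    biweightCount codeMatrix 6 6 = 206 ∧ biweightCount codeMatrix 6 8 = 1495 := by
  constructor <;>
    exact (biweightCount_codeMatrix (q := 4) 1 _ (by norm_num) (by norm_num)).trans
      (by decide +kernel)

theorem biweightCount_codeMatrix_seven :
    biweightCount codeMatrix 7 7 = 1838 :=
  (biweightCount_codeMatrix (q := 4) 2 _ (by norm_num) (by norm_num)).trans (by decide +kernel)

theorem biweightCount_codeMatrix_eq_zero {i j : ℕ} (hij : i ≤ j) (hi : 0 < i) (h : i + j < 12) :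
    biweightCount codeMatrix i j = 0 := by
  have key {q : ℕ} (hq : q ≤ 4)
      (hs : LaneBlock.search 0 (12 - (q + 1)) 0 (LaneBlock.table (q + 1) codeRows).2 0 = 0)
      (hj : q + 1 + j < 12) : biweightCount codeMatrix (q + 1) j = 0 := by
    rw [← sum_biweightCount_codeMatrix (Nat.zero_le _) (by omega) 0 hq, zero_add] at hs
    exact Finset.sum_eq_zero_iff.1 hs j (Finset.mem_Ico.2 ⟨j.zero_le, by omega⟩)
  obtain rfl | rfl | rfl | rfl | rfl : i = 1 ∨ i = 2 ∨ i = 3 ∨ i = 4 ∨ i = 5 := by omega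
  all_goals exact key (by norm_num) (by decide +kernel) h

theorem sum_range_antidiagonal_12 {b : ℕ → ℕ → ℕ} (comm : ∀ i j, b i j = b j i) :
    ∑ i ∈ Finset.range (12 + 1), b i (12 - i) =
      2 * (b 0 12 + b 1 11 + b 2 10 + b 3 9 + b 4 8 + b 5 7) + b 6 6 := by
  simp only [Finset.sum_range_succ, Finset.sum_range_zero, Nat.reduceSub, comm 7 5, comm 8 4,
    comm 9 3, comm 10 2, comm 11 1, comm 12 0]
  ring

theorem sum_range_antidiagonal_14 {b : ℕ → ℕ → ℕ} (comm : ∀ i j, b i j = b j i) :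
    ∑ i ∈ Finset.range (14 + 1), b i (14 - i) =
      2 * (b 0 14 + b 1 13 + b 2 12 + b 3 11 + b 4 10 + b 5 9 + b 6 8) + b 7 7 := by
  simp only [Finset.sum_range_succ, Finset.sum_range_zero, Nat.reduceSub, comm 8 6, comm 9 5,
    comm 10 4, comm 11 3, comm 12 2, comm 13 1, comm 14 0]
  ring

theorem card_graphCode_codeMatrix_12 :
    Nat.card {x // x ∈ graphCode codeMatrix ∧ hamWt x = 12} = 792 := by
  rw [card_graphCode_weight, sum_range_antidiagonal_12 (biweightCount_comm codeMatrix_mul_self),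
    biweightCount_zero_left (by norm_num), biweightCount_codeMatrix_one.1,
    biweightCount_codeMatrix_two.1, biweightCount_codeMatrix_three.1,
    biweightCount_codeMatrix_four.1, biweightCount_codeMatrix_five.1,
    biweightCount_codeMatrix_six.1]

theorem card_graphCode_codeMatrix_14 :
    Nat.card {x // x ∈ graphCode codeMatrix ∧ hamWt x = 14} = 7488 := by
  rw [card_graphCode_weight, sum_range_antidiagonal_14 (biweightCount_comm codeMatrix_mul_self),
    biweightCount_zero_left (by norm_num), biweightCount_codeMatrix_one.2,
    biweightCount_codeMatrix_two.2, biweightCount_codeMatrix_three.2,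
    biweightCount_codeMatrix_four.2, biweightCount_codeMatrix_five.2,
    biweightCount_codeMatrix_six.2, biweightCount_codeMatrix_seven]

/-- There is a self-dual binary linear code of length 72 with minimum nonzero Hamming
weight 12, having exactly 792 codewords of weight 12 and exactly 7488 codewords of
weight 14 (weight enumerator `W_{72,1}` with γ = 18 and β = 396). -/
theorem exists_selfDual_code_72_gamma_18_beta_396 :
    ∃ C : Submodule (ZMod 2) (Fin 72 → ZMod 2),
      IsSelfDual C ∧
      IsLeast {k | ∃ v ∈ C, v ≠ 0 ∧ hamWt v = k} 12 ∧
      Nat.card {v : Fin 72 → ZMod 2 // v ∈ C ∧ hamWt v = 12} = 792 ∧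
      Nat.card {v : Fin 72 → ZMod 2 // v ∈ C ∧ hamWt v = 14} = 7488 := by
  refine ⟨graphCode codeMatrix, isSelfDual_graphCode isSymm_codeMatrix codeMatrix_mul_self,
    ⟨?_, ?_⟩, card_graphCode_codeMatrix_12, card_graphCode_codeMatrix_14⟩
  · obtain ⟨⟨x, hx, hw⟩⟩ : Nonempty {x // x ∈ graphCode codeMatrix ∧ hamWt x = 12} :=
      (Nat.card_pos_iff.1 (by rw [card_graphCode_codeMatrix_12]; norm_num)).1
    refine ⟨x, hx, ?_, hw⟩
    rintro rfl
    simp [hamWt_eq_zero.2] at hw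
  · rintro k ⟨x, hx, h0, rfl⟩
    exact le_hamWt_of_mem_graphCode codeMatrix_mul_self
      (fun _ _ => biweightCount_codeMatrix_eq_zero) hx h0
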